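/- Let g ≥ 3. There exist constants c = c(g) > 0 and K_0 = K_0(g) such that the following holds for all integers K ≥ K_0 and M with g^{K−1} < M ≤ g^K. Let k_1, k_2, k_3 be integers with |k_i − μ_K| ≤ C_g for i = 1,2,3, k_1 + k_2 + k_3 ≡ M (mod g−1), gcd(k_i, k_j) = 1 for i ≠ j, and gcd(k_i, g) = 1 for each i. Then for all integers j_1, j_2, j_3 with 0 ≤ j_i ≤ k_i − 1 for each i and (j_1, j_2, j_3) ∉ J, one has |G(j_1, j_2, j_3)| ≤ c · g^{2K} K^{−29/6}. -/

import Mathlib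

set_option autoImplicit false

open MeasureTheory intervalIntegral

noncomputable section

/-- `e(x) = exp(2πix)`. -/
def eC (x : ℝ) : ℂ := Complex.exp (2 * Real.pi * Complex.I * x)

/-- Base-`g` digit sum. -/
def digitSum (g n : ℕ) : ℕ := (Nat.digits g n).sum

/-- `S_g(k)`: naturals below `g^K` with base-`g` digit sum `k`. -/
def Sset (g K : ℕ) (k : ℤ) : Finset ℕ :=
  (Finset.range (g ^ K)).filter fun n => (digitSum g n : ℤ) = k

/-- The exponential sum `f_k(θ) = Σ_{n ∈ S_g(k)} e(nθ)`. -/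
def fsum (g K : ℕ) (k : ℤ) (θ : ℝ) : ℂ := ∑ n ∈ Sset g K k, eC ((n : ℝ) * θ)

/-- The average digit sum `μ_K = (g-1)K/2`. -/
def muK (g K : ℕ) : ℝ := ((g : ℝ) - 1) * K / 2

/-- `C_g = g(g-1) ∏_{p ≤ 10g², p prime} p`. -/
def Cg (g : ℕ) : ℕ := g * (g - 1) * ∏ p ∈ (Finset.Iic (10 * g ^ 2)).filter Nat.Prime, p

/-- `j` belongs to `{0, k/(g-1), 2k/(g-1), …, (g-2)k/(g-1)} ∩ ℤ`. -/
def inJ (g : ℕ) (k j : ℤ) : Prop := ∃ a : ℕ, a ≤ g - 2 ∧ j * ((g : ℤ) - 1) = (a : ℤ) * k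

/-- `G(j₁,j₂,j₃) = ∫₀¹ f_{k₁}(θ+j₁/k₁) f_{k₂}(θ+j₂/k₂) f_{k₃}(θ+j₃/k₃) e(-Mθ) dθ`. -/
def Gint (g K M : ℕ) (k1 k2 k3 j1 j2 j3 : ℤ) : ℂ :=
  ∫ θ in (0 : ℝ)..1,
    fsum g K k1 (θ + (j1 : ℝ) / (k1 : ℝ)) * fsum g K k2 (θ + (j2 : ℝ) / (k2 : ℝ)) *
      fsum g K k3 (θ + (j3 : ℝ) / (k3 : ℝ)) * eC (-(M : ℝ) * θ)

lemma eC_add (x y : ℝ) : eC (x + y) = eC x * eC y := by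
  simp only [eC, ← Complex.exp_add]
  push_cast
  ring_nf

lemma eC_zero : eC 0 = 1 := by simp [eC]

lemma norm_eC (x : ℝ) : ‖eC x‖ = 1 := by
  have h : eC x = Complex.exp (((2 * Real.pi * x : ℝ) : ℂ) * Complex.I) := by
    simp only [eC]
    push_cast
    ring_nf
  rw [h, Complex.norm_exp_ofReal_mul_I]

lemma conj_eC (x : ℝ) : (starRingEnd ℂ) (eC x) = eC (-x) := by
  simp only [eC, ← Complex.exp_conj]
  simp [Complex.conj_ofNat]

lemma continuous_eC : Continuous eC := by
  unfold eC
  fun_prop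

lemma eC_intCast (n : ℤ) : eC n = 1 := by
  rw [eC, Complex.exp_eq_one_iff]
  exact ⟨n, by push_cast; ring⟩

lemma integral_eC_int_mul (m : ℤ) (s : ℝ) :
    ∫ t in (0 : ℝ)..1, eC ((m : ℝ) * (t + s)) = if m = 0 then 1 else 0 := by
  split_ifs with h
  · simp [h, eC_zero]
  · have hc : (2 * Real.pi * Complex.I * m : ℂ) ≠ 0 := by
      simp [Real.pi_ne_zero, h]
    have h1 : ∀ t : ℝ, eC ((m : ℝ) * (t + s))
        = Complex.exp ((2 * Real.pi * Complex.I * m : ℂ) * t) * eC (m * s) := by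
      intro t
      simp only [eC, ← Complex.exp_add]
      push_cast
      ring_nf
    simp_rw [h1]
    rw [intervalIntegral.integral_mul_const, integral_exp_mul_complex hc]
    have h2 : Complex.exp ((2 * Real.pi * Complex.I * m : ℂ) * ((1 : ℝ) : ℂ)) = 1 := by
      have := eC_intCast m
      simpa [eC] using this
    rw [h2]
    simp

/-- The sum of `e(dx)` over the base-`g` digits `d`. -/
def digitKernel (g : ℕ) (x : ℝ) : ℂ := ∑ d ∈ Finset.range g, eC (d * x)

lemma norm_one_add_eC_le (x : ℝ) : ‖1 + eC x‖ ≤ 2 - Real.sin (Real.pi * x) ^ 2 := by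
  have hs := Real.sin_sq_le_one (Real.pi * x)
  apply abs_le_of_sq_le_sq' _ (by linarith) |>.2
  have h : eC x = Complex.exp (((2 * (Real.pi * x) : ℝ) : ℂ) * Complex.I) := by
    simp only [eC]
    push_cast
    ring_nf
  rw [← Complex.normSq_eq_norm_sq, Complex.normSq_apply, h]
  simp only [Complex.add_re, Complex.add_im, Complex.one_re, Complex.one_im,
    Complex.exp_ofReal_mul_I_re, Complex.exp_ofReal_mul_I_im]
  rw [Real.cos_two_mul, Real.sin_two_mul]
  have hc := Real.sin_sq_add_cos_sq (Real.pi * x)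
  set S := Real.sin (Real.pi * x)
  set C := Real.cos (Real.pi * x)
  have hC : C ^ 2 = 1 - S ^ 2 := by linarith
  nlinarith [sq_nonneg (S ^ 2), sq_nonneg S]

lemma norm_digitKernel_le {g : ℕ} (hg : 2 ≤ g) (x : ℝ) :
    ‖digitKernel g x‖ ≤ g * Real.exp (-(Real.sin (Real.pi * x) ^ 2 / g)) := by
  obtain ⟨h, rfl⟩ : ∃ h, g = h + 2 := ⟨g - 2, by omega⟩
  have h1 : ‖digitKernel (h + 2) x‖ ≤ (h + 2) - Real.sin (Real.pi * x) ^ 2 := by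
    unfold digitKernel
    rw [Finset.sum_range_succ', Finset.sum_range_succ', add_assoc]
    refine (norm_add_le _ _).trans ?_
    have ha : ‖∑ d ∈ Finset.range h, eC (((d + 1 + 1 : ℕ) : ℝ) * x)‖ ≤ h := by
      refine (norm_sum_le _ _).trans ?_
      simp [norm_eC]
    have hb := norm_one_add_eC_le x
    have hc : eC (((0 + 1 : ℕ) : ℝ) * x) + eC (((0 : ℕ) : ℝ) * x) = 1 + eC x := by
      simp [eC_zero, add_comm]
    rw [hc]
    linarith
  refine h1.trans ?_
  have hpos : (0 : ℝ) < ((h + 2 : ℕ) : ℝ) := by positivity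
  have h2 := Real.add_one_le_exp (-(Real.sin (Real.pi * x) ^ 2 / ((h + 2 : ℕ) : ℝ)))
  have h3 := mul_le_mul_of_nonneg_left h2 hpos.le
  refine le_trans (le_of_eq ?_) h3
  field_simp
  push_cast
  ring

lemma sum_range_mul_eq {A : Type*} [AddCommMonoid A] (g N : ℕ) (F : ℕ → A) :
    ∑ n ∈ Finset.range (g * N), F n
      = ∑ m ∈ Finset.range N, ∑ d ∈ Finset.range g, F (g * m + d) := by
  induction N with
  | zero => simp
  | succ N ih => rw [Nat.mul_succ, Finset.sum_range_add, ih, Finset.sum_range_succ]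

lemma digitSum_mul_add {g : ℕ} (hg : 2 ≤ g) (m : ℕ) {d : ℕ} (hd : d < g) :
    digitSum g (g * m + d) = d + digitSum g m := by
  unfold digitSum
  by_cases h : d = 0 ∧ m = 0
  · simp [h.1, h.2]
  · rw [add_comm, Nat.digits_add g (by omega) d m hd (by tauto)]
    simp

/-- The two-variable generating sum factors over the digit positions. -/
lemma sum_eC_digitSum_eq_prod {g : ℕ} (hg : 2 ≤ g) (K : ℕ) (θ t : ℝ) :
    ∑ n ∈ Finset.range (g ^ K), eC (n * θ + digitSum g n * t)
      = ∏ i ∈ Finset.range K, digitKernel g ((g : ℝ) ^ i * θ + t) := by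
  induction K generalizing θ with
  | zero => simp [digitSum, eC_zero]
  | succ K ih =>
    rw [pow_succ', sum_range_mul_eq, Finset.prod_range_succ']
    have h1 : ∀ i, digitKernel g ((g : ℝ) ^ (i + 1) * θ + t)
        = digitKernel g ((g : ℝ) ^ i * (g * θ) + t) := by
      intro i
      ring_nf
    simp_rw [h1]
    rw [← ih, Finset.sum_mul]
    refine Finset.sum_congr rfl fun m _ => ?_
    rw [digitKernel, Finset.mul_sum]
    refine Finset.sum_congr rfl fun d hd => ?_
    rw [digitSum_mul_add hg m (Finset.mem_range.mp hd), ← eC_add]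
    push_cast
    ring_nf

lemma fsum_eq_integral {g : ℕ} (hg : 2 ≤ g) (K : ℕ) (k : ℤ) (θ : ℝ) :
    fsum g K k θ = ∫ t in (0 : ℝ)..1,
      (∏ i ∈ Finset.range K, digitKernel g ((g : ℝ) ^ i * θ + t)) * eC (-(k * t)) := by
  simp_rw [← sum_eC_digitSum_eq_prod hg, Finset.sum_mul]
  rw [intervalIntegral.integral_finsetSum]
  · unfold fsum Sset
    rw [Finset.sum_filter]
    refine Finset.sum_congr rfl fun n _ => ?_
    have h1 : ∀ t : ℝ, eC (n * θ + digitSum g n * t) * eC (-(k * t))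
        = eC (n * θ) * eC ((((digitSum g n : ℤ) - k : ℤ) : ℝ) * (t + 0)) := by
      intro t
      rw [← eC_add, ← eC_add]
      push_cast
      ring_nf
    simp_rw [h1]
    rw [intervalIntegral.integral_const_mul, integral_eC_int_mul]
    simp [sub_eq_zero]
  · intro n _
    apply Continuous.intervalIntegrable
    have := continuous_eC
    fun_prop

lemma sin_sub_sq_le (x y : ℝ) :
    Real.sin (x - y) ^ 2 ≤ 2 * (Real.sin x ^ 2 + Real.sin y ^ 2) := by
  rw [Real.sin_sub]
  have h1 := Real.sin_sq_add_cos_sq x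
  have h2 := Real.sin_sq_add_cos_sq y
  nlinarith [sq_nonneg (Real.sin x * Real.cos y + Real.cos x * Real.sin y),
    mul_nonneg (sq_nonneg (Real.sin x)) (sq_nonneg (Real.sin y))]

/-- The energy `∑_{i < K-1} sin²(π (g-1) g^i θ)` controlling the decay of `f_k(θ)`. -/
def sinEnergy (g K : ℕ) (θ : ℝ) : ℝ :=
  ∑ i ∈ Finset.range (K - 1), Real.sin (Real.pi * (((g : ℝ) - 1) * (g : ℝ) ^ i * θ)) ^ 2

lemma sinEnergy_le_sum (g K : ℕ) (θ t : ℝ) :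
    sinEnergy g K θ
      ≤ 4 * ∑ i ∈ Finset.range K, Real.sin (Real.pi * ((g : ℝ) ^ i * θ + t)) ^ 2 := by
  cases K with
  | zero => simp [sinEnergy]
  | succ K =>
    unfold sinEnergy
    have h1 : ∀ i ∈ Finset.range K,
        Real.sin (Real.pi * (((g : ℝ) - 1) * (g : ℝ) ^ i * θ)) ^ 2
          ≤ 2 * (Real.sin (Real.pi * ((g : ℝ) ^ (i + 1) * θ + t)) ^ 2
            + Real.sin (Real.pi * ((g : ℝ) ^ i * θ + t)) ^ 2) := by
      intro i _
      refine le_trans (le_of_eq ?_) (sin_sub_sq_le _ _)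
      congr 2
      ring
    refine (Finset.sum_le_sum h1).trans ?_
    rw [← Finset.mul_sum, Finset.sum_add_distrib]
    have h2 := Finset.sum_range_succ
      (fun i => Real.sin (Real.pi * ((g : ℝ) ^ i * θ + t)) ^ 2) K
    have h3 := Finset.sum_range_succ'
      (fun i => Real.sin (Real.pi * ((g : ℝ) ^ i * θ + t)) ^ 2) K
    have h4 := sq_nonneg (Real.sin (Real.pi * ((g : ℝ) ^ K * θ + t)))
    have h5 := sq_nonneg (Real.sin (Real.pi * ((g : ℝ) ^ 0 * θ + t)))
    linarith

lemma norm_fsum_le {g : ℕ} (hg : 2 ≤ g) (K : ℕ) (k : ℤ) (θ : ℝ) :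
    ‖fsum g K k θ‖ ≤ (g : ℝ) ^ K * Real.exp (-(sinEnergy g K θ / (4 * g))) := by
  have hg0 : (0 : ℝ) < g := by exact_mod_cast (by omega : 0 < g)
  rw [fsum_eq_integral hg]
  have key : ∀ t ∈ Set.uIoc (0 : ℝ) 1,
      ‖(∏ i ∈ Finset.range K, digitKernel g ((g : ℝ) ^ i * θ + t)) * eC (-(k * t))‖
        ≤ (g : ℝ) ^ K * Real.exp (-(sinEnergy g K θ / (4 * g))) := by
    intro t _
    rw [norm_mul, norm_eC, mul_one, norm_prod]
    refine (Finset.prod_le_prod (fun _ _ => norm_nonneg _)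
      fun i _ => norm_digitKernel_le hg _).trans ?_
    rw [Finset.prod_mul_distrib, Finset.prod_const, Finset.card_range, ← Real.exp_sum,
      Finset.sum_neg_distrib, ← Finset.sum_div]
    refine mul_le_mul_of_nonneg_left (Real.exp_le_exp.mpr (neg_le_neg ?_)) (by positivity)
    rw [div_le_div_iff₀ (by positivity) hg0]
    nlinarith [sinEnergy_le_sum g K θ t]
  simpa using intervalIntegral.norm_integral_le_of_norm_le_const key

lemma continuous_fsum (g K : ℕ) (k : ℤ) : Continuous (fsum g K k) := by
  unfold fsum
  have := continuous_eC
  fun_prop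

lemma integral_norm_fsum_sq_le (g K : ℕ) (k : ℤ) (s : ℝ) :
    ∫ θ in (0 : ℝ)..1, ‖fsum g K k (θ + s)‖ ^ 2 ≤ (g : ℝ) ^ K := by
  have h1 : ∀ θ : ℝ, ((‖fsum g K k (θ + s)‖ ^ 2 : ℝ) : ℂ)
      = ∑ n ∈ Sset g K k, ∑ m ∈ Sset g K k, eC ((((n : ℤ) - m : ℤ) : ℝ) * (θ + s)) := by
    intro θ
    push_cast
    rw [← Complex.mul_conj', fsum, map_sum, Finset.sum_mul_sum]
    refine Finset.sum_congr rfl fun n _ => Finset.sum_congr rfl fun m _ => ?_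
    rw [conj_eC, ← eC_add]
    ring_nf
  have hc : ∀ r : ℝ, IntervalIntegrable (fun θ => eC (r * (θ + s))) volume 0 1 := by
    intro r
    apply Continuous.intervalIntegrable
    have := continuous_eC
    fun_prop
  have h2 : ((∫ θ in (0 : ℝ)..1, ‖fsum g K k (θ + s)‖ ^ 2 : ℝ) : ℂ) = ((Sset g K k).card : ℂ) := by
    rw [← intervalIntegral.integral_ofReal]
    simp_rw [h1]
    rw [intervalIntegral.integral_finsetSum]
    · have : ∀ n ∈ Sset g K k, ∫ θ in (0 : ℝ)..1,
          ∑ m ∈ Sset g K k, eC ((((n : ℤ) - m : ℤ) : ℝ) * (θ + s)) = 1 := by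
        intro n hn
        rw [intervalIntegral.integral_finsetSum fun m _ => hc _]
        simp_rw [integral_eC_int_mul, sub_eq_zero, Nat.cast_inj]
        simp [hn]
      rw [Finset.sum_congr rfl this]
      simp
    · intro n _
      apply Continuous.intervalIntegrable
      have := continuous_eC
      fun_prop
  have h3 : ∫ θ in (0 : ℝ)..1, ‖fsum g K k (θ + s)‖ ^ 2 = ((Sset g K k).card : ℝ) := by
    exact_mod_cast h2
  rw [h3]
  have h4 : (Sset g K k).card ≤ g ^ K := by
    simpa [Sset] using Finset.card_filter_le (Finset.range (g ^ K))
      fun n => (digitSum g n : ℤ) = k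
  exact_mod_cast h4

lemma two_mul_abs_sub_round_le_abs_sin (x : ℝ) :
    2 * |x - round x| ≤ |Real.sin (Real.pi * x)| := by
  have h1 : |Real.sin (Real.pi * x)| = |Real.sin (Real.pi * (x - round x))| := by
    rw [mul_sub, mul_comm Real.pi (round x : ℝ), Real.sin_sub_int_mul_pi]
    simp [abs_mul]
  have hpi := Real.pi_pos
  have h2 : |Real.pi * (x - round x)| ≤ Real.pi / 2 := by
    rw [abs_mul, abs_of_pos hpi]
    nlinarith [abs_sub_round x]
  have h3 := Real.mul_abs_le_abs_sin h2
  rw [h1]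
  refine le_trans (le_of_eq ?_) h3
  rw [abs_mul, abs_of_pos hpi]
  field_simp

/-- Multiplication by `g` expands small distances to the nearest integer. -/
lemma mul_abs_sub_round_le {g : ℕ} {x : ℝ} (hx : 2 * g * |x - round x| < 1) :
    g * |x - round x| ≤ |g * x - round (g * x)| := by
  have e : (g : ℝ) * |x - round x| = |g * x - g * round x| := by
    rw [← mul_sub, abs_mul, Nat.abs_cast]
  rw [mul_assoc] at hx
  rw [e] at hx ⊢
  by_cases h : round ((g : ℝ) * x) = g * round x
  · rw [h]
    push_cast
    exact le_rfl
  · have h1 : (1 : ℝ) ≤ |(g : ℝ) * round x - round ((g : ℝ) * x)| := by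
      have : (1 : ℤ) ≤ |(g : ℤ) * round x - round ((g : ℝ) * x)| :=
        Int.one_le_abs (sub_ne_zero.mpr (Ne.symm h))
      exact_mod_cast this
    have h2 := abs_sub_le ((g : ℝ) * round x) (g * x) (round ((g : ℝ) * x))
    rw [abs_sub_comm ((g : ℝ) * round x) (g * x)] at h2
    linarith

lemma exists_lt_one_le_abs_sin {g : ℕ} (hg : 0 < g) {b q : ℤ} (hq : 0 < q) (hb : ¬ q ∣ b) {L : ℕ}
    (hL : (q : ℝ) ≤ (g : ℝ) ^ L) :
    ∃ i < L, 1 / (g : ℝ) ≤ |Real.sin (Real.pi * ((g : ℝ) ^ i * ((b : ℝ) / q)))| := by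
  by_contra! hcon
  have hq' : (0 : ℝ) < q := by exact_mod_cast hq
  have hg' : (0 : ℝ) < g := by exact_mod_cast hg
  set x : ℝ := (b : ℝ) / q with hx
  have key : ∀ i ≤ L, (g : ℝ) ^ i / q ≤ |(g : ℝ) ^ i * x - round ((g : ℝ) ^ i * x)| := by
    intro i
    induction i with
    | zero =>
      intro _
      simp only [pow_zero, one_mul]
      have h1 : (1 : ℤ) ≤ |b - q * round x| := by
        apply Int.one_le_abs
        intro h
        exact hb ⟨round x, by linarith⟩
      have h2 : (1 : ℝ) ≤ |(b : ℝ) - q * round x| := by exact_mod_cast h1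
      have h3 : x - round x = ((b : ℝ) - q * round x) / q := by
        rw [hx]
        field_simp
      rw [h3, abs_div, abs_of_pos hq']
      gcongr
    | succ i ih =>
      intro hi
      have h1 := ih (by omega)
      have h2 := hcon i (by omega)
      have h3 := two_mul_abs_sub_round_le_abs_sin ((g : ℝ) ^ i * x)
      have h4 : 2 * g * |(g : ℝ) ^ i * x - round ((g : ℝ) ^ i * x)| < 1 := by
        have h5 := h3.trans_lt h2
        rw [lt_div_iff₀ hg'] at h5
        linarith
      have h6 := mul_abs_sub_round_le h4
      rw [← mul_assoc, ← pow_succ'] at h6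
      refine le_trans ?_ h6
      rw [pow_succ', mul_div_assoc]
      gcongr
  have h1 := key L le_rfl
  have h2 := abs_sub_round ((g : ℝ) ^ L * x)
  have h3 : 1 ≤ (g : ℝ) ^ L / q := by rwa [one_le_div hq']
  linarith

lemma sum_sin_sq_ge {g : ℕ} (hg : 0 < g) {b q : ℤ} (hq : 0 < q) (hb : ¬ q ∣ b)
    (hco : IsCoprime q (g : ℤ)) {L : ℕ} (hL : (q : ℝ) ≤ (g : ℝ) ^ L) (A : ℕ) :
    (A : ℝ) / (g : ℝ) ^ 2
      ≤ ∑ i ∈ Finset.range (L * A), Real.sin (Real.pi * ((g : ℝ) ^ i * ((b : ℝ) / q))) ^ 2 := by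
  rw [sum_range_mul_eq]
  have h1 : ∀ a ∈ Finset.range A, 1 / (g : ℝ) ^ 2 ≤ ∑ d ∈ Finset.range L,
      Real.sin (Real.pi * ((g : ℝ) ^ (L * a + d) * ((b : ℝ) / q))) ^ 2 := by
    intro a _
    have hb' : ¬ q ∣ (g : ℤ) ^ (L * a) * b := fun h => hb (hco.pow_right.dvd_of_dvd_mul_left h)
    obtain ⟨i, hi, h⟩ := exists_lt_one_le_abs_sin hg hq hb' hL
    refine le_trans ?_ (Finset.single_le_sum (f := fun d =>
      Real.sin (Real.pi * ((g : ℝ) ^ (L * a + d) * ((b : ℝ) / q))) ^ 2)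
      (fun _ _ => sq_nonneg _) (Finset.mem_range.mpr hi))
    have e : (g : ℝ) ^ (L * a + i) * ((b : ℝ) / q)
        = (g : ℝ) ^ i * ((((g : ℤ) ^ (L * a) * b : ℤ) : ℝ) / q) := by
      push_cast
      ring
    rw [← one_div_pow]
    simp only [e]
    rw [← sq_abs (Real.sin _)]
    gcongr
  refine le_trans (le_of_eq ?_) (Finset.sum_le_sum h1)
  simp [div_eq_mul_inv]

lemma sinEnergy_sub_le (g K : ℕ) (x y : ℝ) :
    sinEnergy g K (x - y) ≤ 2 * (sinEnergy g K x + sinEnergy g K y) := by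
  unfold sinEnergy
  rw [← Finset.sum_add_distrib, Finset.mul_sum]
  refine Finset.sum_le_sum fun i _ => ?_
  rw [mul_sub, mul_sub]
  exact sin_sub_sq_le _ _

/-- A rational shift not cleared by `g - 1` has large energy. -/
lemma sinEnergy_rat_ge {g : ℕ} (hg : 0 < g) {a q : ℤ} (hq : 0 < q)
    (ha : ¬ q ∣ ((g : ℤ) - 1) * a) (hco : IsCoprime q (g : ℤ)) {K L : ℕ}
    (hL : (q : ℝ) ≤ (g : ℝ) ^ (L + 1)) (hK : (L + 1) ^ 2 ≤ K) :
    (L : ℝ) / (g : ℝ) ^ 2 ≤ sinEnergy g K ((a : ℝ) / q) := by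
  refine (sum_sin_sq_ge hg hq ha hco hL L).trans ?_
  have hsub : Finset.range ((L + 1) * L) ⊆ Finset.range (K - 1) := by
    apply Finset.range_subset_range.mpr
    have : (L + 1) ^ 2 = (L + 1) * L + L + 1 := by ring
    omega
  refine le_trans (le_of_eq ?_)
    (Finset.sum_le_sum_of_subset_of_nonneg hsub fun _ _ _ => sq_nonneg _)
  refine Finset.sum_congr rfl fun i _ => ?_
  congr 3
  push_cast
  ring

lemma min_norm_fsum_le {g : ℕ} (hg : 2 ≤ g) {K L : ℕ} {a q : ℤ} (hq : 0 < q)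
    (ha : ¬ q ∣ ((g : ℤ) - 1) * a) (hco : IsCoprime q (g : ℤ))
    (hL : (q : ℝ) ≤ (g : ℝ) ^ (L + 1)) (hK : (L + 1) ^ 2 ≤ K) (k l : ℤ) {x y : ℝ}
    (hxy : x - y = (a : ℝ) / q) :
    ‖fsum g K k x‖ ≤ (g : ℝ) ^ K * Real.exp (-(L / (16 * (g : ℝ) ^ 3))) ∨
      ‖fsum g K l y‖ ≤ (g : ℝ) ^ K * Real.exp (-(L / (16 * (g : ℝ) ^ 3))) := by
  have hg' : (0 : ℝ) < g := by exact_mod_cast (by omega : 0 < g)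
  have h1 := sinEnergy_rat_ge (by omega) hq ha hco hL hK
  rw [← hxy] at h1
  have h2 := h1.trans (sinEnergy_sub_le g K x y)
  have key : ∀ (m : ℤ) (z : ℝ), (L : ℝ) / (g : ℝ) ^ 2 ≤ 4 * sinEnergy g K z →
      ‖fsum g K m z‖ ≤ (g : ℝ) ^ K * Real.exp (-(L / (16 * (g : ℝ) ^ 3))) := by
    intro m z hz
    refine (norm_fsum_le hg K m z).trans ?_
    refine mul_le_mul_of_nonneg_left (Real.exp_le_exp.mpr (neg_le_neg ?_)) (by positivity)
    have e : (L : ℝ) / (16 * (g : ℝ) ^ 3) = (L / (g : ℝ) ^ 2) / (16 * g) := by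
      field_simp
    rw [e, div_le_div_iff₀ (by positivity) (by positivity)]
    nlinarith
  rcases le_total (sinEnergy g K x) (sinEnergy g K y) with h | h
  · exact Or.inr (key l y (by linarith))
  · exact Or.inl (key k x (by linarith))

lemma mul_mul_le_of_le_or_le {u v w E : ℝ} (hu : 0 ≤ u) (hv : 0 ≤ v) (hw : 0 ≤ w) (hE : 0 ≤ E)
    (h : u ≤ E ∨ v ≤ E) : u * v * w ≤ E * (u ^ 2 + v ^ 2 + w ^ 2) := by
  rcases h with h | h
  · calc u * v * w = u * (v * w) := by ring
      _ ≤ E * (v * w) := by gcongr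
      _ ≤ _ := by
        gcongr
        nlinarith [sq_nonneg (v - w), sq_nonneg u, sq_nonneg v, sq_nonneg w]
  · calc u * v * w = v * (u * w) := by ring
      _ ≤ E * (u * w) := by gcongr
      _ ≤ _ := by
        gcongr
        nlinarith [sq_nonneg (u - w), sq_nonneg u, sq_nonneg v, sq_nonneg w]

lemma norm_Gint_le {g K M : ℕ} {k1 k2 k3 j1 j2 j3 : ℤ} {E : ℝ}
    (h : ∀ θ : ℝ,
      ‖fsum g K k1 (θ + (j1 : ℝ) / (k1 : ℝ))‖ * ‖fsum g K k2 (θ + (j2 : ℝ) / (k2 : ℝ))‖ *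
        ‖fsum g K k3 (θ + (j3 : ℝ) / (k3 : ℝ))‖ ≤
      (g : ℝ) ^ K * E * (‖fsum g K k1 (θ + (j1 : ℝ) / (k1 : ℝ))‖ ^ 2 +
        ‖fsum g K k2 (θ + (j2 : ℝ) / (k2 : ℝ))‖ ^ 2 +
        ‖fsum g K k3 (θ + (j3 : ℝ) / (k3 : ℝ))‖ ^ 2)) (hE : 0 ≤ E) :
    ‖Gint g K M k1 k2 k3 j1 j2 j3‖ ≤ 3 * (g : ℝ) ^ (2 * K) * E := by
  have hi : ∀ (k : ℤ) (s : ℝ),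
      IntervalIntegrable (fun θ => ‖fsum g K k (θ + s)‖ ^ 2) volume 0 1 := by
    intro k s
    apply Continuous.intervalIntegrable
    have := continuous_fsum g K k
    fun_prop
  have h1 : ‖Gint g K M k1 k2 k3 j1 j2 j3‖ ≤ ∫ θ in (0 : ℝ)..1,
      (g : ℝ) ^ K * E * (‖fsum g K k1 (θ + (j1 : ℝ) / (k1 : ℝ))‖ ^ 2 +
        ‖fsum g K k2 (θ + (j2 : ℝ) / (k2 : ℝ))‖ ^ 2 +
        ‖fsum g K k3 (θ + (j3 : ℝ) / (k3 : ℝ))‖ ^ 2) := by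
    refine intervalIntegral.norm_integral_le_of_norm_le zero_le_one ?_ ?_
    · refine Filter.Eventually.of_forall fun θ _ => ?_
      rw [norm_mul, norm_mul, norm_mul, norm_eC, mul_one]
      exact h θ
    · exact (((hi _ _).add (hi _ _)).add (hi _ _)).const_mul _
  refine h1.trans ?_
  rw [intervalIntegral.integral_const_mul,
    intervalIntegral.integral_add ((hi _ _).add (hi _ _)) (hi _ _),
    intervalIntegral.integral_add (hi _ _) (hi _ _)]
  have e : 3 * (g : ℝ) ^ (2 * K) * E
      = (g : ℝ) ^ K * E * ((g : ℝ) ^ K + (g : ℝ) ^ K + (g : ℝ) ^ K) := by ring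
  rw [e]
  gcongr <;> exact integral_norm_fsum_sq_le _ _ _ _

lemma inJ_of_dvd {g : ℕ} (hg : 2 ≤ g) {k j : ℤ} (hj0 : 0 ≤ j) (hj : j ≤ k - 1)
    (h : k ∣ ((g : ℤ) - 1) * j) : inJ g k j := by
  obtain ⟨a, ha⟩ := h
  have hk : 0 < k := by linarith
  have hg' : (1 : ℤ) ≤ (g : ℤ) - 1 := by
    have : (2 : ℤ) ≤ g := by exact_mod_cast hg
    linarith
  have ha0 : 0 ≤ a := by
    by_contra! hneg
    nlinarith [mul_nonneg (by linarith : (0 : ℤ) ≤ (g : ℤ) - 1) hj0]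
  have ha1 : a < (g : ℤ) - 1 := by
    by_contra! hge
    nlinarith [mul_le_mul_of_nonneg_left hge hk.le]
  refine ⟨a.toNat, by omega, ?_⟩
  rw [Int.toNat_of_nonneg ha0]
  linarith

lemma dvd_of_mul_dvd_cross {m k l i j : ℤ} (hco : IsCoprime k l)
    (h : k * l ∣ m * (i * l - j * k)) : k ∣ m * i ∧ l ∣ m * j := by
  constructor
  · have h1 : k ∣ m * i * l := by
      have h2 := (dvd_mul_right k l).trans h
      have e : m * i * l = m * (i * l - j * k) + k * (m * j) := by ring
      rw [e]
      exact dvd_add h2 (dvd_mul_right _ _)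
    exact hco.dvd_of_dvd_mul_right h1
  · have h1 : l ∣ m * j * k := by
      have h2 := (dvd_mul_left l k).trans h
      have e : m * j * k = l * (m * i) - m * (i * l - j * k) := by ring
      rw [e]
      exact dvd_sub (dvd_mul_right _ _) h2
    exact hco.symm.dvd_of_dvd_mul_right h1

lemma eventually_pow_le_const_pow {r : ℝ} (hr : 1 < r) (n : ℕ) (C : ℝ) :
    ∀ᶠ L : ℕ in Filter.atTop, C * ((L : ℝ) + 2) ^ n ≤ r ^ L := by
  have h0 := tendsto_pow_const_div_const_pow_of_one_lt n hr
  have h1 : Filter.Tendsto (fun L : ℕ => |C| * r ^ 2 * (((L + 2 : ℕ) : ℝ) ^ n / r ^ (L + 2)))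
      Filter.atTop (nhds (|C| * r ^ 2 * 0)) :=
    ((Filter.tendsto_add_atTop_iff_nat 2).mpr h0).const_mul _
  rw [mul_zero] at h1
  filter_upwards [h1.eventually_le_const zero_lt_one] with L hL
  have hr0 : 0 < r := by linarith
  have e : |C| * r ^ 2 * (((L + 2 : ℕ) : ℝ) ^ n / r ^ (L + 2))
      = |C| * ((L : ℝ) + 2) ^ n / r ^ L := by
    push_cast
    rw [pow_add]
    field_simp
  rw [e, div_le_one (by positivity)] at hL
  refine le_trans ?_ hL
  gcongr
  exact le_abs_self C

theorem statement16 (g : ℕ) (hg : 3 ≤ g) :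
    ∃ c : ℝ, 0 < c ∧ ∃ K0 : ℕ, ∀ K : ℕ, K0 ≤ K →
      ∀ M : ℕ, g ^ (K - 1) < M → M ≤ g ^ K →
      ∀ k1 k2 k3 : ℤ,
        |(k1 : ℝ) - muK g K| ≤ Cg g →
        |(k2 : ℝ) - muK g K| ≤ Cg g →
        |(k3 : ℝ) - muK g K| ≤ Cg g →
        k1 + k2 + k3 ≡ (M : ℤ) [ZMOD ((g : ℤ) - 1)] →
        Int.gcd k1 k2 = 1 → Int.gcd k1 k3 = 1 → Int.gcd k2 k3 = 1 →
        Int.gcd k1 (g : ℤ) = 1 → Int.gcd k2 (g : ℤ) = 1 → Int.gcd k3 (g : ℤ) = 1 →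
      ∀ j1 j2 j3 : ℤ,
        0 ≤ j1 → j1 ≤ k1 - 1 → 0 ≤ j2 → j2 ≤ k2 - 1 → 0 ≤ j3 → j3 ≤ k3 - 1 →
        ¬(inJ g k1 j1 ∧ inJ g k2 j2 ∧ inJ g k3 j3) →
        ‖Gint g K M k1 k2 k3 j1 j2 j3‖ ≤
          c * (g : ℝ) ^ (2 * K) * (K : ℝ) ^ (-(29 : ℝ) / 6) := by
  have hg2 : 2 ≤ g := by omega
  have hgR : (3 : ℝ) ≤ g := by exact_mod_cast hg
  have hr : 1 < Real.exp (1 / (16 * (g : ℝ) ^ 3)) := Real.one_lt_exp_iff.mpr (by positivity)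
  obtain ⟨L0, hL0⟩ := Filter.eventually_atTop.mp
    ((eventually_pow_le_const_pow hr 10 1).and
      (eventually_pow_le_const_pow (by linarith : (1 : ℝ) < g) 4 ((g : ℝ) ^ 2)))
  refine ⟨3, by norm_num, (L0 + 1) ^ 2 + 2 * Cg g + 1, ?_⟩
  intro K hK M _ _ k1 k2 k3 hk1 hk2 hk3 _ h12 h13 _ h1g h2g h3g j1 j2 j3
    hj1 hj1' hj2 hj2' hj3 hj3' hJ
  obtain ⟨L, hL⟩ : ∃ L, Nat.sqrt K = L + 1 := by
    refine ⟨Nat.sqrt K - 1, ?_⟩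
    have : 1 ≤ Nat.sqrt K := Nat.le_sqrt.mpr (by omega)
    omega
  have hLK : (L + 1) ^ 2 ≤ K := by
    rw [← hL]
    exact Nat.sqrt_le' K
  have hKL : K ≤ (L + 2) ^ 2 := by
    have := Nat.lt_succ_sqrt' K
    rw [hL] at this
    exact this.le
  have hLL0 : L0 ≤ L := by
    have : L0 + 1 ≤ Nat.sqrt K := Nat.le_sqrt'.mpr (by omega)
    omega
  obtain ⟨hexp, hpow⟩ := hL0 L hLL0
  have hKR : (K : ℝ) ≤ ((L : ℝ) + 2) ^ 2 := by exact_mod_cast hKL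
  have hKC : 2 * (Cg g : ℝ) + 1 ≤ K := by
    have : 2 * Cg g + 1 ≤ K := by omega
    exact_mod_cast this
  have hKpos : (1 : ℝ) ≤ K := by
    have : 1 ≤ K := by omega
    exact_mod_cast this
  have hkpos : ∀ k : ℤ, |(k : ℝ) - muK g K| ≤ Cg g → 0 < k ∧ (k : ℝ) ≤ g * K := by
    intro k hk
    rw [abs_le, muK] at hk
    constructor
    · have : (0 : ℝ) < k := by nlinarith
      exact_mod_cast this
    · nlinarith
  set E : ℝ := Real.exp (-(L / (16 * (g : ℝ) ^ 3))) with hE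
  have hEle : E ≤ (K : ℝ) ^ (-(29 : ℝ) / 6) := by
    have h1 : (K : ℝ) ^ ((29 : ℝ) / 6) ≤ Real.exp (L / (16 * (g : ℝ) ^ 3)) := by
      calc (K : ℝ) ^ ((29 : ℝ) / 6) ≤ (K : ℝ) ^ ((5 : ℕ) : ℝ) :=
            Real.rpow_le_rpow_of_exponent_le hKpos (by norm_num)
        _ = (K : ℝ) ^ 5 := Real.rpow_natCast _ _
        _ ≤ (((L : ℝ) + 2) ^ 2) ^ 5 := by gcongr
        _ = 1 * ((L : ℝ) + 2) ^ 10 := by ring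
        _ ≤ _ := hexp
        _ = _ := by rw [← Real.exp_nat_mul, mul_one_div]
    rw [hE, Real.exp_neg, neg_div, Real.rpow_neg (by positivity)]
    gcongr
  have hq : ∀ k l : ℤ, 0 < k ∧ (k : ℝ) ≤ g * K → 0 < l ∧ (l : ℝ) ≤ g * K →
      ((k * l : ℤ) : ℝ) ≤ (g : ℝ) ^ (L + 1) := by
    rintro k l ⟨hk0, hk⟩ ⟨hl0, hl⟩
    have hl0' : (0 : ℝ) ≤ l := by exact_mod_cast hl0.le
    push_cast
    calc (k : ℝ) * l ≤ (g * K) * (g * K) := by gcongr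
      _ ≤ (g * ((L : ℝ) + 2) ^ 2) * (g * ((L : ℝ) + 2) ^ 2) := by gcongr
      _ = (g : ℝ) ^ 2 * ((L : ℝ) + 2) ^ 4 := by ring
      _ ≤ (g : ℝ) ^ L := hpow
      _ ≤ _ := pow_le_pow_right₀ (by linarith) (by omega)
  obtain hk1 := hkpos k1 hk1
  obtain hk2 := hkpos k2 hk2
  obtain hk3 := hkpos k3 hk3
  have small : ∀ k l i j : ℤ, 0 < k ∧ (k : ℝ) ≤ g * K → 0 < l ∧ (l : ℝ) ≤ g * K →
      Int.gcd k g = 1 → Int.gcd l g = 1 → ¬ k * l ∣ ((g : ℤ) - 1) * (i * l - j * k) →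
      ∀ θ : ℝ, ‖fsum g K k (θ + (i : ℝ) / (k : ℝ))‖ ≤ (g : ℝ) ^ K * E ∨
        ‖fsum g K l (θ + (j : ℝ) / (l : ℝ))‖ ≤ (g : ℝ) ^ K * E := by
    intro k l i j hk hl hkg hlg hn θ
    refine min_norm_fsum_le hg2 (mul_pos hk.1 hl.1) hn
      ((Int.isCoprime_iff_gcd_eq_one.mpr hkg).mul_left (Int.isCoprime_iff_gcd_eq_one.mpr hlg))
      (hq k l hk hl) hLK k l ?_
    have hk0 : (k : ℝ) ≠ 0 := by exact_mod_cast hk.1.ne'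
    have hl0 : (l : ℝ) ≠ 0 := by exact_mod_cast hl.1.ne'
    push_cast
    field_simp
    ring
  have hG : ‖Gint g K M k1 k2 k3 j1 j2 j3‖ ≤ 3 * (g : ℝ) ^ (2 * K) * E := by
    refine norm_Gint_le (fun θ => ?_) (Real.exp_pos _).le
    have hE0 : 0 ≤ (g : ℝ) ^ K * E := by positivity
    by_cases h : k1 * k2 ∣ ((g : ℤ) - 1) * (j1 * k2 - j2 * k1)
    · have h' : ¬ k1 * k3 ∣ ((g : ℤ) - 1) * (j1 * k3 - j3 * k1) := by
        intro h'
        have a := dvd_of_mul_dvd_cross (Int.isCoprime_iff_gcd_eq_one.mpr h12) h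
        have b := dvd_of_mul_dvd_cross (Int.isCoprime_iff_gcd_eq_one.mpr h13) h'
        exact hJ ⟨inJ_of_dvd hg2 hj1 hj1' a.1, inJ_of_dvd hg2 hj2 hj2' a.2,
          inJ_of_dvd hg2 hj3 hj3' b.2⟩
      have := mul_mul_le_of_le_or_le (norm_nonneg _) (norm_nonneg _)
        (norm_nonneg (fsum g K k2 (θ + (j2 : ℝ) / (k2 : ℝ)))) hE0
        (small k1 k3 j1 j3 hk1 hk3 h1g h3g h' θ)
      linarith
    · exact mul_mul_le_of_le_or_le (norm_nonneg _) (norm_nonneg _) (norm_nonneg _) hE0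
        (small k1 k2 j1 j2 hk1 hk2 h1g h2g h θ)
  refine hG.trans ?_
  gcongr
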